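/- Let D, L₁, L₂, B > 0. There exists a constant C₁ > 0 (depending only on L₁, L₂, B, D) with the following property. Let n ≥ 2, d ≥ 1, let Θ ⊆ ℝ^d be a nonempty compact set of diameter at most D, and let l₁, …, l_n : ℝ^d → ℝ be differentiable functions of the form l_i(θ) = f(⟨x_i, θ⟩, y_i) + r(θ), where f(a, y) is L₁-Lipschitz and L₂-smooth in a for every y, ‖x_i‖ ≤ B, and r is a fixed differentiable function. Let θ̂* be a minimizer of F_n(θ) = n⁻¹ Σ_{i=1}^n l_i(θ) over Θ. Let σ be a uniformly random permutation of {1,…,n}, and for 1 ≤ a < n set ∇l_{1:a}(θ) = a⁻¹ Σ_{i=1}^a ∇l_{σ(i)}(θ) and ∇l_{a+1:n}(θ) = (n−a)⁻¹ Σ_{i=a+1}^n ∇l_{σ(i)}(θ). Then E[( sup_{θ∈Θ, θ≠θ̂*} ⟨∇l_{1:a}(θ) − ∇l_{a+1:n}(θ), (θ − θ̂*)/‖θ − θ̂*‖⟩ )²] ≤ C₁² (1/√a + 1/√(n−a))², where the expectation is over the random permutation σ. -/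

import Mathlib

open scoped RealInnerProductSpace

/-- Flipping the sign at one index does not change a sum over all sign vectors. -/
theorem sum_signs_flip {ι : Type*} [Fintype ι] [DecidableEq ι] (F : (ι → ℤˣ) → ℝ) (k : ι) :
    ∑ ε : ι → ℤˣ, F (ε * Pi.mulSingle k (-1)) = ∑ ε, F ε :=
  Equiv.sum_comp (Equiv.mulRight (Pi.mulSingle k (-1) : ι → ℤˣ)) F

theorem sum_signs_mul_eq_zero {ι : Type*} [Fintype ι] [DecidableEq ι] {i j : ι} (hij : i ≠ j) :
    ∑ ε : ι → ℤˣ, ((ε i : ℤ) : ℝ) * ((ε j : ℤ) : ℝ) = 0 := by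
  have h := sum_signs_flip (fun ε : ι → ℤˣ => ((ε i : ℤ) : ℝ) * ((ε j : ℤ) : ℝ)) i
  simp [Pi.mulSingle_eq_of_ne hij.symm] at h
  linarith

theorem intUnit_cast_mul_self (s : ℤˣ) : ((s : ℤ) : ℝ) * ((s : ℤ) : ℝ) = 1 := by
  rcases Int.units_eq_one_or s with rfl | rfl <;> norm_num

/-- The second moment of the norm of a Rademacher sum of vectors. -/
theorem sum_signs_norm_sq {ι F : Type*} [Fintype ι] [DecidableEq ι] [NormedAddCommGroup F]
    [InnerProductSpace ℝ F] (z : ι → F) :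
    ∑ ε : ι → ℤˣ, ‖∑ i, ((ε i : ℤ) : ℝ) • z i‖ ^ 2 =
      Fintype.card (ι → ℤˣ) * ∑ i, ‖z i‖ ^ 2 := by
  have expand (ε : ι → ℤˣ) : ‖∑ i, ((ε i : ℤ) : ℝ) • z i‖ ^ 2 =
      ∑ i, ∑ j, ((ε i : ℤ) : ℝ) * ((ε j : ℤ) : ℝ) * ⟪z i, z j⟫ := by
    rw [← real_inner_self_eq_norm_sq, sum_inner]
    refine Finset.sum_congr rfl fun i _ => ?_
    rw [inner_sum]
    refine Finset.sum_congr rfl fun j _ => ?_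
    rw [real_inner_smul_left, real_inner_smul_right]
    ring
  simp_rw [expand]
  rw [Finset.sum_comm, Finset.mul_sum]
  refine Finset.sum_congr rfl fun i _ => ?_
  rw [Finset.sum_comm, Finset.sum_eq_single i]
  · simp_rw [intUnit_cast_mul_self, one_mul, real_inner_self_eq_norm_sq]
    simp
  · intro j _ hj
    rw [← Finset.sum_mul, sum_signs_mul_eq_zero hj.symm, zero_mul]
  · simp

theorem le_ciSup_of_finite {S : Type*} [Finite S] (F : S → ℝ) (s : S) : F s ≤ ⨆ s, F s :=
  le_ciSup (Set.finite_range F).bddAbove s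

theorem ciSup_add_ciSup_sub_le {S J : Type*} [Finite S] [Nonempty S] [Fintype J] [Nonempty J]
    (R φ : S → ℝ) (g : J → S → ℝ)
    (h : ∀ s t, Fintype.card J * |φ s - φ t| ≤ ∑ j, |g j s - g j t|) :
    Fintype.card J * ((⨆ s, (R s + φ s)) + ⨆ s, (R s - φ s)) ≤
      ∑ j, ((⨆ s, (R s + g j s)) + ⨆ s, (R s - g j s)) := by
  obtain ⟨s, hs⟩ := exists_eq_ciSup_of_finite (f := fun s => R s + φ s)
  obtain ⟨t, ht⟩ := exists_eq_ciSup_of_finite (f := fun s => R s - φ s)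
  have key (j : J) : R s + R t + |g j s - g j t| ≤
      (⨆ s, (R s + g j s)) + ⨆ s, (R s - g j s) := by
    have h1 := le_ciSup_of_finite (fun s => R s + g j s) s
    have h2 := le_ciSup_of_finite (fun s => R s + g j s) t
    have h3 := le_ciSup_of_finite (fun s => R s - g j s) s
    have h4 := le_ciSup_of_finite (fun s => R s - g j s) t
    rcases abs_cases (g j s - g j t) with ⟨h, _⟩ | ⟨h, _⟩ <;> rw [h] <;> linarith
  rw [← hs, ← ht]
  calc (Fintype.card J : ℝ) * (R s + φ s + (R t - φ t))
      ≤ Fintype.card J * (R s + R t + |φ s - φ t|) := by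
        refine mul_le_mul_of_nonneg_left ?_ (Nat.cast_nonneg _)
        linarith [le_abs_self (φ s - φ t)]
    _ ≤ Fintype.card J * (R s + R t) + ∑ j, |g j s - g j t| := by
        rw [mul_add]; gcongr; exact h s t
    _ = ∑ j, (R s + R t + |g j s - g j t|) := by
        rw [Finset.sum_add_distrib, Finset.sum_const, Finset.card_univ, nsmul_eq_mul]
    _ ≤ _ := Finset.sum_le_sum fun j _ => key j

theorem two_mul_sum_signs_ciSup {S ι : Type*} [Fintype ι] [DecidableEq ι]
    (U : S → ℝ) (φ : ι → S → ℝ) (k : ι) (g : S → ℝ) :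
    2 * ∑ ε : ι → ℤˣ, ⨆ s, (U s + ∑ i, ((ε i : ℤ) : ℝ) * Function.update φ k g i s) =
      ∑ ε : ι → ℤˣ, ((⨆ s, (U s + ∑ i ∈ Finset.univ.erase k, ((ε i : ℤ) : ℝ) * φ i s + g s)) +
        ⨆ s, (U s + ∑ i ∈ Finset.univ.erase k, ((ε i : ℤ) : ℝ) * φ i s - g s)) := by
  have hsplit (ε : ι → ℤˣ) (s : S) :
      U s + ∑ i, ((ε i : ℤ) : ℝ) * Function.update φ k g i s =
      U s + ∑ i ∈ Finset.univ.erase k, ((ε i : ℤ) : ℝ) * φ i s + ((ε k : ℤ) : ℝ) * g s := by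
    rw [← Finset.sum_erase_add _ _ (Finset.mem_univ k), Function.update_self, ← add_assoc]
    congr 2
    refine Finset.sum_congr rfl fun i hi => ?_
    rw [Function.update_of_ne (Finset.ne_of_mem_erase hi)]
  have hflip (ε : ι → ℤˣ) (s : S) :
      U s + ∑ i ∈ Finset.univ.erase k,
        (((ε * Pi.mulSingle k (-1) : ι → ℤˣ) i : ℤ) : ℝ) * φ i s +
          (((ε * Pi.mulSingle k (-1) : ι → ℤˣ) k : ℤ) : ℝ) * g s =
      U s + ∑ i ∈ Finset.univ.erase k, ((ε i : ℤ) : ℝ) * φ i s - ((ε k : ℤ) : ℝ) * g s := by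
    have : ∑ i ∈ Finset.univ.erase k,
        (((ε * Pi.mulSingle k (-1) : ι → ℤˣ) i : ℤ) : ℝ) * φ i s =
        ∑ i ∈ Finset.univ.erase k, ((ε i : ℤ) : ℝ) * φ i s :=
      Finset.sum_congr rfl fun i hi => by
        simp [Pi.mulSingle_eq_of_ne (Finset.ne_of_mem_erase hi)]
    rw [this]
    simp [sub_eq_add_neg]
  rw [two_mul]
  nth_rewrite 2 [← sum_signs_flip _ k]
  rw [← Finset.sum_add_distrib]
  refine Finset.sum_congr rfl fun ε _ => ?_
  simp_rw [hsplit, hflip]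
  rcases Int.units_eq_one_or (ε k) with h | h <;> rw [h]
  · simp
  · simp only [Units.val_neg, Units.val_one, Int.cast_neg, Int.cast_one, neg_mul, one_mul,
      sub_neg_eq_add, ← sub_eq_add_neg]
    exact add_comm _ _

/-- One step of the contraction principle: one function may be replaced by one of the functions
that jointly control its increments. -/
theorem exists_sum_signs_ciSup_update_le {S ι J : Type*} [Finite S] [Nonempty S] [Fintype ι]
    [DecidableEq ι] [Fintype J] [Nonempty J] (U : S → ℝ) (φ : ι → S → ℝ) (k : ι) (g : J → S → ℝ)
    (h : ∀ s t, Fintype.card J * |φ k s - φ k t| ≤ ∑ j, |g j s - g j t|) :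
    ∃ j, ∑ ε : ι → ℤˣ, ⨆ s, (U s + ∑ i, ((ε i : ℤ) : ℝ) * φ i s) ≤
      ∑ ε : ι → ℤˣ, ⨆ s, (U s + ∑ i, ((ε i : ℤ) : ℝ) * Function.update φ k (g j) i s) := by
  have hφ := two_mul_sum_signs_ciSup U φ k (φ k)
  rw [Function.update_eq_self] at hφ
  obtain ⟨j, -, hj⟩ := Finset.exists_le_of_sum_le (s := (Finset.univ : Finset J))
    (f := fun _ => 2 * ∑ ε : ι → ℤˣ, ⨆ s, (U s + ∑ i, ((ε i : ℤ) : ℝ) * φ i s))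
    (g := fun j => 2 * ∑ ε : ι → ℤˣ,
      ⨆ s, (U s + ∑ i, ((ε i : ℤ) : ℝ) * Function.update φ k (g j) i s))
    Finset.univ_nonempty (by
      simp_rw [two_mul_sum_signs_ciSup, hφ]
      rw [Finset.sum_const, Finset.card_univ, nsmul_eq_mul, Finset.mul_sum]
      conv_rhs => rw [Finset.sum_comm]
      exact Finset.sum_le_sum fun ε _ => ciSup_add_ciSup_sub_le _ _ _ h)
  exact ⟨j, by linarith⟩

/-- Contraction principle for Rademacher averages with several controlling functions. -/
theorem exists_sum_signs_ciSup_le {S ι J : Type*} [Finite S] [Nonempty S] [Fintype ι]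
    [DecidableEq ι] [Fintype J] [Nonempty J] (U : S → ℝ) (φ : ι → S → ℝ) (g : ι → J → S → ℝ)
    (h : ∀ i s t, Fintype.card J * |φ i s - φ i t| ≤ ∑ j, |g i j s - g i j t|) :
    ∃ c : ι → J, ∑ ε : ι → ℤˣ, ⨆ s, (U s + ∑ i, ((ε i : ℤ) : ℝ) * φ i s) ≤
      ∑ ε : ι → ℤˣ, ⨆ s, (U s + ∑ i, ((ε i : ℤ) : ℝ) * g i (c i) s) := by
  suffices H : ∀ A : Finset ι, ∃ c : ι → J,
      ∑ ε : ι → ℤˣ, ⨆ s, (U s + ∑ i, ((ε i : ℤ) : ℝ) * φ i s) ≤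
      ∑ ε : ι → ℤˣ, ⨆ s, (U s + ∑ i, ((ε i : ℤ) : ℝ) *
        (if i ∈ A then g i (c i) else φ i) s) by
    simpa using H Finset.univ
  intro A
  induction A using Finset.induction_on with
  | empty => exact ⟨fun _ => Classical.arbitrary J, by simp⟩
  | insert k A hk ih =>
    obtain ⟨c, hc⟩ := ih
    obtain ⟨j, hj⟩ := exists_sum_signs_ciSup_update_le U
      (fun i => if i ∈ A then g i (c i) else φ i) k (g k) (by simpa [hk] using h k)
    refine ⟨Function.update c k j, hc.trans (hj.trans_eq ?_)⟩
    have : Function.update (fun i => if i ∈ A then g i (c i) else φ i) k (g k j) =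
        fun i => if i ∈ insert k A then g i (Function.update c k j i) else φ i := by
      funext i
      by_cases hi : i = k
      · subst hi; simp
      · simp [hi]
    rw [this]

/-- Second-moment bound for the supremum of a Rademacher process whose increments are controlled,
after multiplication by an arbitrary scalar, by finitely many linear functionals. -/
theorem sum_signs_ciSup_sq_le {T ι J F : Type*} [Finite T] [Nonempty T] [Fintype ι]
    [DecidableEq ι] [Fintype J] [Nonempty J] [NormedAddCommGroup F] [InnerProductSpace ℝ F]
    (h : ι → T → ℝ) (z : ι → J → F) (V : T → F) {κ R : ℝ}
    (hz : ∀ i j, ‖z i j‖ ≤ R) (hV : ∀ t, ‖V t‖ ≤ κ)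
    (hh : ∀ i s t (w w' : ℝ), |w * h i s - w' * h i t| ≤ ∑ j, |⟪z i j, w • V s - w' • V t⟫|) :
    ∑ ε : ι → ℤˣ, ⨆ t, (∑ i, ((ε i : ℤ) : ℝ) * h i t) ^ 2 ≤
      Fintype.card (ι → ℤˣ) * ((Fintype.card J * κ * R) ^ 2 * Fintype.card ι) := by
  choose τ hτ using fun ε : ι → ℤˣ =>
    exists_eq_ciSup_of_finite (f := fun t => (∑ i, ((ε i : ℤ) : ℝ) * h i t) ^ 2)
  set w : (ι → ℤˣ) → ℝ := fun ε => ∑ i, ((ε i : ℤ) : ℝ) * h i (τ ε) with hw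
  set q : ℝ := (Fintype.card J : ℝ) with hq
  have hq0 : 0 ≤ q := Nat.cast_nonneg _
  obtain ⟨c, hc⟩ := exists_sum_signs_ciSup_le (S := ι → ℤˣ) (J := J) (fun s => -(w s) ^ 2)
    (fun i s => 2 * (w s * h i (τ s)))
    (fun i j s => 2 * q * ⟪z i j, w s • V (τ s)⟫) (by
      intro i s t
      simp_rw [← mul_sub, ← inner_sub_right, abs_mul, ← Finset.mul_sum]
      rw [abs_two, abs_of_nonneg hq0, ← hq]
      nlinarith [mul_le_mul_of_nonneg_left (hh i (τ s) (τ t) (w s) (w t)) hq0])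
  calc ∑ ε : ι → ℤˣ, ⨆ t, (∑ i, ((ε i : ℤ) : ℝ) * h i t) ^ 2
      ≤ ∑ ε : ι → ℤˣ, ⨆ s, (-(w s) ^ 2 +
          ∑ i, ((ε i : ℤ) : ℝ) * (2 * (w s * h i (τ s)))) := by
        refine Finset.sum_le_sum fun ε _ => ?_
        rw [← hτ ε]
        refine le_trans (le_of_eq ?_) (le_ciSup_of_finite _ ε)
        have : ∑ i, ((ε i : ℤ) : ℝ) * (2 * (w ε * h i (τ ε))) = 2 * w ε * w ε := by
          conv_rhs => rw [hw]
          simp only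
          rw [Finset.mul_sum]
          exact Finset.sum_congr rfl fun i _ => by ring
        rw [this]
        simp only [hw]
        ring
    _ ≤ _ := hc
    _ ≤ ∑ ε : ι → ℤˣ, (q * κ) ^ 2 * ‖∑ i, ((ε i : ℤ) : ℝ) • z i (c i)‖ ^ 2 := by
        refine Finset.sum_le_sum fun ε _ => ciSup_le fun s => ?_
        set Z := ∑ i, ((ε i : ℤ) : ℝ) • z i (c i) with hZ
        have h1 : ∑ i, ((ε i : ℤ) : ℝ) * (2 * q * ⟪z i (c i), w s • V (τ s)⟫) =
            2 * q * (w s * ⟪Z, V (τ s)⟫) := by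
          rw [hZ, sum_inner, Finset.mul_sum, Finset.mul_sum]
          refine Finset.sum_congr rfl fun i _ => ?_
          rw [real_inner_smul_left, real_inner_smul_right]
          ring
        have h2 : ⟪Z, V (τ s)⟫ ^ 2 ≤ (κ * ‖Z‖) ^ 2 := by
          rw [← sq_abs]
          gcongr
          calc |⟪Z, V (τ s)⟫| ≤ ‖Z‖ * ‖V (τ s)‖ := abs_real_inner_le_norm _ _
            _ ≤ ‖Z‖ * κ := by gcongr; exact hV _
            _ = κ * ‖Z‖ := mul_comm _ _
        rw [h1]
        nlinarith [sq_nonneg (w s - q * ⟪Z, V (τ s)⟫),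
          mul_le_mul_of_nonneg_left h2 (sq_nonneg q)]
    _ = Fintype.card (ι → ℤˣ) * ((q * κ) ^ 2 * ∑ i, ‖z i (c i)‖ ^ 2) := by
        rw [← Finset.mul_sum, sum_signs_norm_sq]
        ring
    _ ≤ Fintype.card (ι → ℤˣ) * ((q * κ) ^ 2 * ∑ _i : ι, R ^ 2) := by
        gcongr with i
        exact hz _ _
    _ = _ := by
        simp only [Finset.sum_const, Finset.card_univ, nsmul_eq_mul]
        ring

/-- Second-moment Rademacher bound for products of a bounded Lipschitz function of one linear form
with another linear form. -/
theorem sum_signs_ciSup_sq_mul_inner_le {T ι H : Type*} [Finite T] [Nonempty T] [Fintype ι]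
    [DecidableEq ι] [NormedAddCommGroup H] [InnerProductSpace ℝ H] {D L1 L2 B : ℝ}
    (hD : 0 ≤ D) (hL1 : 0 ≤ L1) (hL2 : 0 ≤ L2) (hB : 0 ≤ B)
    (x : ι → H) (hx : ∀ i, ‖x i‖ ≤ B) (P Q : T → H) (hP : ∀ t, ‖P t‖ ≤ D) (hQ : ∀ t, ‖Q t‖ ≤ 1)
    (G : ι → T → ℝ) (hG : ∀ i t, |G i t| ≤ L1)
    (hGl : ∀ i s t, |G i s - G i t| ≤ L2 * |⟪x i, P s⟫ - ⟪x i, P t⟫|) :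
    ∑ ε : ι → ℤˣ, ⨆ t, (∑ i, ((ε i : ℤ) : ℝ) * (G i t * ⟪x i, Q t⟫)) ^ 2 ≤
      Fintype.card (ι → ℤˣ) *
        ((3 * (D + 2) * (L2 * B * B + L1 * B + (2 * (L1 * B) + L2 * B * (B * D)))) ^ 2 *
          Fintype.card ι) := by
  set γ : ℝ := 2 * (L1 * B) + L2 * B * (B * D) with hγ
  have hγ0 : 0 ≤ γ := by positivity
  have hp (i t) : |⟪x i, P t⟫| ≤ B * D := (abs_real_inner_le_norm _ _).trans (by
    gcongr
    exacts [hx i, hP t])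
  have hq (i t) : |⟪x i, Q t⟫| ≤ B := (abs_real_inner_le_norm _ _).trans (by
    calc ‖x i‖ * ‖Q t‖ ≤ B * 1 := by
          gcongr
          exacts [hx i, hQ t]
      _ = B := mul_one B)
  have := sum_signs_ciSup_sq_le (J := Fin 3) (F := WithLp 2 (H × WithLp 2 (H × ℝ)))
    (fun i t => G i t * ⟪x i, Q t⟫)
    (fun i => ![WithLp.toLp 2 ((L2 * B) • x i, 0), WithLp.toLp 2 (0, WithLp.toLp 2 (L1 • x i, 0)),
      WithLp.toLp 2 (0, WithLp.toLp 2 (0, γ))])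
    (fun t => WithLp.toLp 2 (P t, WithLp.toLp 2 (Q t, 1)))
    (κ := D + 2) (R := L2 * B * B + L1 * B + γ) ?_ ?_ ?_
  · simpa using this
  · intro i j
    have h1 : L2 * B * ‖x i‖ ≤ L2 * B * B := by gcongr; exact hx i
    have h2 : L1 * ‖x i‖ ≤ L1 * B := by gcongr; exact hx i
    have h3 : 0 ≤ L2 * B * B := by positivity
    have h4 : 0 ≤ L1 * B := by positivity
    refine abs_le_of_sq_le_sq' ?_ (by positivity) |>.2
    fin_cases j <;>
      simp [norm_smul, abs_of_nonneg, hL1, hL2, hB]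
    all_goals
      gcongr
      linarith
  · intro t
    refine abs_le_of_sq_le_sq' ?_ (by positivity) |>.2
    simp [WithLp.prod_norm_sq_eq_of_L2]
    have h1 : ‖P t‖ ^ 2 ≤ D ^ 2 := by gcongr; exact hP t
    have h2 : ‖Q t‖ ^ 2 ≤ 1 ^ 2 := by gcongr; exact hQ t
    nlinarith
  · intro i s t w w'
    have pull (c p p' : ℝ) (hc : 0 ≤ c) :
        |w * (c * p) - w' * (c * p')| = c * |w * p - w' * p'| := by
      rw [← abs_of_nonneg hc, ← abs_mul, abs_of_nonneg hc]
      ring_nf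
    simp only [Fin.sum_univ_three, WithLp.prod_inner_apply]
    simp [real_inner_smul_left, inner_sub_right, real_inner_smul_right, abs_mul,
      abs_of_nonneg, hγ0]
    rw [pull _ _ _ (mul_nonneg hL2 hB), pull _ _ _ hL1]
    set p := ⟪x i, P s⟫
    set p' := ⟪x i, P t⟫
    set q := ⟪x i, Q s⟫
    set q' := ⟪x i, Q t⟫
    have e : w * (G i s * q) - w' * (G i t * q') =
        (w - w') * (G i s * q) + w' * (G i s - G i t) * q
          + (w * q - w' * q' - (w - w') * q) * G i t := by ring
    have e2 : |w'| * |p - p'| ≤ |w * p - w' * p'| + |w - w'| * (B * D) := by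
      rw [← abs_mul]
      have : w' * (p - p') = (w * p - w' * p') - (w - w') * p := by ring
      rw [this]
      refine (abs_sub _ _).trans ?_
      rw [abs_mul (w - w')]
      gcongr
      exact hp i s
    have a1 : |(w - w') * (G i s * q)| ≤ |w - w'| * (L1 * B) := by
      rw [abs_mul, abs_mul (G i s)]
      gcongr
      exacts [hG i s, hq i s]
    have a2 : |w' * (G i s - G i t) * q| ≤
        L2 * B * (|w * p - w' * p'| + |w - w'| * (B * D)) := by
      rw [abs_mul, abs_mul w']
      calc |w'| * |G i s - G i t| * |q| ≤ |w'| * (L2 * |p - p'|) * B := by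
            gcongr
            exacts [hGl i s t, hq i s]
        _ = L2 * B * (|w'| * |p - p'|) := by ring
        _ ≤ _ := by gcongr
    have a3 : |(w * q - w' * q' - (w - w') * q) * G i t| ≤
        (|w * q - w' * q'| + |w - w'| * B) * L1 := by
      rw [abs_mul]
      gcongr
      · refine (abs_sub _ _).trans ?_
        rw [abs_mul (w - w')]
        gcongr
        exact hq i s
      · exact hG i t
    rw [e]
    refine (abs_add_three _ _ _).trans ((add_le_add (add_le_add a1 a2) a3).trans (le_of_eq ?_))
    rw [hγ]
    ring

/-- The permutation of `ι × ℤˣ` exchanging the two copies of those `i` with `ε i = -1`. -/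
def signSwap {ι : Type*} (ε : ι → ℤˣ) : Equiv.Perm (ι × ℤˣ) where
  toFun p := (p.1, ε p.1 * p.2)
  invFun p := (p.1, ε p.1 * p.2)
  left_inv p := by simp [← mul_assoc]
  right_inv p := by simp [← mul_assoc]

/-- Symmetrization of a paired difference under a uniformly random permutation. -/
theorem sum_perm_ciSup_sq_paired_le {T ι N : Type*} [Finite T] [Nonempty T] [Fintype ι]
    [DecidableEq ι] [Fintype N] [DecidableEq N] (h : N → T → ℝ) (v : ι × ℤˣ ↪ N) {K : ℝ}
    (hK : ∀ j : ι → N, ∑ ε : ι → ℤˣ, ⨆ t, (∑ i, ((ε i : ℤ) : ℝ) * h (j i) t) ^ 2 ≤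
      Fintype.card (ι → ℤˣ) * K) :
    ∑ σ : Equiv.Perm N, ⨆ t, (∑ i, (h (σ (v (i, 1))) t - h (σ (v (i, -1))) t)) ^ 2 ≤
      Fintype.card (Equiv.Perm N) * (4 * K) := by
  set X : Equiv.Perm N → ℝ := fun σ =>
    ⨆ t, (∑ i, (h (σ (v (i, 1))) t - h (σ (v (i, -1))) t)) ^ 2 with hX
  set c : ℝ := (Fintype.card (ι → ℤˣ) : ℝ) with hc
  have hc0 : 0 < c := by rw [hc]; exact_mod_cast Fintype.card_pos
  have hsymm (σ : Equiv.Perm N) (ε : ι → ℤˣ) :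
      X (σ * (signSwap ε).viaEmbedding v) ≤
        2 * (⨆ t, (∑ i, ((ε i : ℤ) : ℝ) * h (σ (v (i, 1))) t) ^ 2) +
        2 * ⨆ t, (∑ i, ((ε i : ℤ) : ℝ) * h (σ (v (i, -1))) t) ^ 2 := by
    refine ciSup_le fun t => ?_
    have e : ∑ i, (h ((σ * (signSwap ε).viaEmbedding v) (v (i, 1))) t -
          h ((σ * (signSwap ε).viaEmbedding v) (v (i, -1))) t) =
        ∑ i, ((ε i : ℤ) : ℝ) * h (σ (v (i, 1))) t -
          ∑ i, ((ε i : ℤ) : ℝ) * h (σ (v (i, -1))) t := by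
      rw [← Finset.sum_sub_distrib]
      refine Finset.sum_congr rfl fun i _ => ?_
      rw [Equiv.Perm.mul_apply, Equiv.Perm.mul_apply, Equiv.Perm.viaEmbedding_apply,
        Equiv.Perm.viaEmbedding_apply]
      rcases Int.units_eq_one_or (ε i) with hε | hε <;> simp [signSwap, hε]
      ring
    rw [e]
    have h1 := le_ciSup_of_finite (fun t => (∑ i, ((ε i : ℤ) : ℝ) * h (σ (v (i, 1))) t) ^ 2) t
    have h2 := le_ciSup_of_finite (fun t => (∑ i, ((ε i : ℤ) : ℝ) * h (σ (v (i, -1))) t) ^ 2) t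
    nlinarith [sq_nonneg (∑ i, ((ε i : ℤ) : ℝ) * h (σ (v (i, 1))) t +
      ∑ i, ((ε i : ℤ) : ℝ) * h (σ (v (i, -1))) t)]
  refine le_of_mul_le_mul_left ?_ hc0
  calc c * ∑ σ, X σ = ∑ ε : ι → ℤˣ, ∑ σ, X (σ * (signSwap ε).viaEmbedding v) := by
        have hinv (ε : ι → ℤˣ) : ∑ σ, X (σ * (signSwap ε).viaEmbedding v) = ∑ σ, X σ :=
          Equiv.sum_comp (Equiv.mulRight ((signSwap ε).viaEmbedding v)) X
        simp_rw [hinv]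
        simp [hc]
    _ = ∑ σ, ∑ ε : ι → ℤˣ, X (σ * (signSwap ε).viaEmbedding v) := Finset.sum_comm
    _ ≤ ∑ _σ : Equiv.Perm N, (2 * (c * K) + 2 * (c * K)) := by
        refine Finset.sum_le_sum fun σ _ =>
          (Finset.sum_le_sum fun ε _ => hsymm σ ε).trans ?_
        rw [Finset.sum_add_distrib, ← Finset.mul_sum, ← Finset.mul_sum]
        gcongr
        exacts [hK fun i => σ (v (i, 1)), hK fun i => σ (v (i, -1))]
    _ = _ := by
        rw [Finset.sum_const, Finset.card_univ, nsmul_eq_mul]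
        ring

/-- Comparison of the averages over two disjoint blocks of a uniformly random permutation. -/
theorem sum_perm_ciSup_sq_avg_sub_avg_le {T N : Type*} [Finite T] [Nonempty T]
    [Fintype N] [DecidableEq N] {a m : ℕ} (ha : 0 < a) (ham : a ≤ m) (h : N → T → ℝ)
    (u : Fin a ↪ N) (v : Fin m ↪ N) (huv : ∀ i k, u i ≠ v k) {K : ℝ}
    (hK : ∀ j : Fin a → N, ∑ ε : Fin a → ℤˣ, ⨆ t, (∑ i, ((ε i : ℤ) : ℝ) * h (j i) t) ^ 2 ≤
      Fintype.card (Fin a → ℤˣ) * (K * a)) :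
    ∑ σ : Equiv.Perm N, ⨆ t, ((a : ℝ)⁻¹ * ∑ i, h (σ (u i)) t -
        (m : ℝ)⁻¹ * ∑ k, h (σ (v k)) t) ^ 2 ≤
      Fintype.card (Equiv.Perm N) * (4 * K / a) := by
  have hm : 0 < m := ha.trans_le ham
  have : NeZero m := ⟨hm.ne'⟩
  have ha' : (0 : ℝ) < a := by exact_mod_cast ha
  have hm' : (0 : ℝ) < m := by exact_mod_cast hm
  set e : Fin a → Fin m := Fin.castLE ham
  have einj : Function.Injective e := Fin.castLE_injective ham
  have hinj (k : Fin m) : Function.Injective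
      (fun p : Fin a × ℤˣ => if p.2 = 1 then u p.1 else v (e p.1 + k)) := by
    rintro ⟨i, b⟩ ⟨j, b'⟩ hij
    rcases Int.units_eq_one_or b with rfl | rfl <;>
      rcases Int.units_eq_one_or b' with rfl | rfl <;> simp at hij ⊢
    · exact hij
    · exact (huv _ _ hij).elim
    · exact (huv _ _ hij.symm).elim
    · exact einj hij
  have hpair (k : Fin m) := sum_perm_ciSup_sq_paired_le h ⟨_, hinj k⟩ hK
  simp only [Function.Embedding.coeFn_mk, if_true,
    show ((-1 : ℤˣ) = 1) = False by simp, if_false] at hpair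
  set X : Fin m → Equiv.Perm N → T → ℝ := fun k σ t =>
    ∑ i, (h (σ (u i)) t - h (σ (v (e i + k))) t) with hX
  have havg (σ : Equiv.Perm N) (t : T) :
      (a : ℝ)⁻¹ * ∑ i, h (σ (u i)) t - (m : ℝ)⁻¹ * ∑ k, h (σ (v k)) t =
        ((a : ℝ)⁻¹ * (m : ℝ)⁻¹) * ∑ k, X k σ t := by
    have h1 : ∑ k, X k σ t = m * ∑ i, h (σ (u i)) t - a * ∑ k, h (σ (v k)) t := by
      simp only [hX, Finset.sum_sub_distrib]
      rw [Finset.sum_comm (f := fun k i => h (σ (v (e i + k))) t)]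
      have (i : Fin a) : ∑ k, h (σ (v (e i + k))) t = ∑ k, h (σ (v k)) t :=
        Equiv.sum_comp (Equiv.addLeft (e i)) fun k => h (σ (v k)) t
      simp [this]
    rw [h1]
    field_simp
  have hjensen (σ : Equiv.Perm N) :
      ⨆ t, ((a : ℝ)⁻¹ * ∑ i, h (σ (u i)) t - (m : ℝ)⁻¹ * ∑ k, h (σ (v k)) t) ^ 2 ≤
        (a : ℝ)⁻¹ ^ 2 * (m : ℝ)⁻¹ * ∑ k, ⨆ t, X k σ t ^ 2 := by
    refine ciSup_le fun t => ?_
    rw [havg]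
    have h1 : (∑ k, X k σ t) ^ 2 ≤ m * ∑ k, X k σ t ^ 2 := by
      simpa using sq_sum_le_card_mul_sum_sq (s := Finset.univ) (f := fun k => X k σ t)
    calc ((a : ℝ)⁻¹ * (m : ℝ)⁻¹ * ∑ k, X k σ t) ^ 2
        = (a : ℝ)⁻¹ ^ 2 * (m : ℝ)⁻¹ ^ 2 * (∑ k, X k σ t) ^ 2 := by ring
      _ ≤ (a : ℝ)⁻¹ ^ 2 * (m : ℝ)⁻¹ ^ 2 * (m * ∑ k, X k σ t ^ 2) := by gcongr
      _ = (a : ℝ)⁻¹ ^ 2 * (m : ℝ)⁻¹ * ∑ k, X k σ t ^ 2 := by field_simp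
      _ ≤ _ := by
        gcongr with k
        exact le_ciSup_of_finite (fun t => X k σ t ^ 2) t
  calc _ ≤ ∑ σ : Equiv.Perm N, (a : ℝ)⁻¹ ^ 2 * (m : ℝ)⁻¹ * ∑ k, ⨆ t, X k σ t ^ 2 :=
        Finset.sum_le_sum fun σ _ => hjensen σ
    _ = (a : ℝ)⁻¹ ^ 2 * (m : ℝ)⁻¹ * ∑ k, ∑ σ : Equiv.Perm N, ⨆ t, X k σ t ^ 2 := by
        rw [← Finset.mul_sum, Finset.sum_comm]
    _ ≤ (a : ℝ)⁻¹ ^ 2 * (m : ℝ)⁻¹ *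
          ∑ _k : Fin m, Fintype.card (Equiv.Perm N) * (4 * (K * a)) := by
        gcongr with k
        exact hpair k
    _ = _ := by
        rw [Finset.sum_const, Finset.card_univ, Fintype.card_fin, nsmul_eq_mul]
        field_simp

/-- The version for the first `a` and the last `m` positions of a random permutation of
`Fin (a + m)`. -/
theorem sum_perm_ciSup_sq_head_sub_tail_le {T : Type*} [Finite T] [Nonempty T] {a m : ℕ}
    (ha : 0 < a) (hm : 0 < m) (h : Fin (a + m) → T → ℝ) {K : ℝ} (hK0 : 0 ≤ K)
    (hK : ∀ (b : ℕ) (j : Fin b → Fin (a + m)),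
      ∑ ε : Fin b → ℤˣ, ⨆ t, (∑ i, ((ε i : ℤ) : ℝ) * h (j i) t) ^ 2 ≤
        Fintype.card (Fin b → ℤˣ) * (K * b)) :
    ∑ σ : Equiv.Perm (Fin (a + m)), ⨆ t, ((a : ℝ)⁻¹ * ∑ i, h (σ (Fin.castAdd m i)) t -
        (m : ℝ)⁻¹ * ∑ k, h (σ (Fin.natAdd a k)) t) ^ 2 ≤
      Fintype.card (Equiv.Perm (Fin (a + m))) *
        (4 * K * (1 / Real.sqrt a + 1 / Real.sqrt m) ^ 2) := by
  have ha' : (0 : ℝ) < a := by exact_mod_cast ha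
  have hm' : (0 : ℝ) < m := by exact_mod_cast hm
  have hdisj (i : Fin a) (k : Fin m) : Fin.castAddEmb m i ≠ Fin.natAddEmb a k := by
    intro h
    have := congrArg Fin.val h
    simp at this
    omega
  have hsq (b : ℝ) (hb : 0 < b) : 1 / b = (1 / Real.sqrt b) ^ 2 := by
    rw [div_pow, Real.sq_sqrt hb.le, one_pow]
  rcases le_total a m with ham | ham
  · refine (sum_perm_ciSup_sq_avg_sub_avg_le ha ham h (Fin.castAddEmb m) (Fin.natAddEmb a)
      hdisj (hK a)).trans ?_
    rw [div_eq_mul_one_div (4 * K), hsq a ha']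
    gcongr
    exact le_add_of_nonneg_right (by positivity)
  · have := sum_perm_ciSup_sq_avg_sub_avg_le hm ham h (Fin.natAddEmb a) (Fin.castAddEmb m)
      (fun k i => (hdisj i k).symm) (hK m)
    simp_rw [← neg_sub ((a : ℝ)⁻¹ * _), neg_sq] at this
    refine this.trans ?_
    rw [div_eq_mul_one_div (4 * K), hsq m hm']
    gcongr
    exact le_add_of_nonneg_left (by positivity)

/-- A bound on the sum of squares valid for all choices of elements passes to the suprema. -/
theorem sum_sSup_sq_le {ι : Type*} [Fintype ι] (V : ι → Set ℝ) (hne : ∀ i, (V i).Nonempty)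
    (hbdd : ∀ i, BddAbove (V i)) {K : ℝ}
    (hK : ∀ z : ι → ℝ, (∀ i, z i ∈ V i) → ∑ i, z i ^ 2 ≤ K) :
    ∑ i, sSup (V i) ^ 2 ≤ K := by
  have hmem : (fun i => sSup (V i)) ∈ closure (Set.univ.pi V) := by
    rw [closure_pi_set]
    exact fun i _ => csSup_mem_closure (hne i) (hbdd i)
  have hclosed : IsClosed {z : ι → ℝ | ∑ i, z i ^ 2 ≤ K} :=
    isClosed_le (by fun_prop) continuous_const
  exact closure_minimal (s := Set.univ.pi V) (fun z hz => hK z fun i => hz i (Set.mem_univ i))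
    hclosed hmem

theorem abs_deriv_le_of_forall_abs_sub_le {g : ℝ → ℝ} {L : ℝ} (hL : 0 ≤ L)
    (hg : ∀ a b, |g a - g b| ≤ L * |a - b|) (b : ℝ) : |deriv g b| ≤ L := by
  have : LipschitzWith ⟨L, hL⟩ g := LipschitzWith.of_dist_le_mul hg
  exact norm_deriv_le_of_lipschitz (x₀ := b) this

theorem abs_deriv_sub_deriv_le {g : ℝ → ℝ} {L : ℝ}
    (hg : ∀ a b, |g a - g b - deriv g b * (a - b)| ≤ L / 2 * |a - b| ^ 2) (a b : ℝ) :
    |deriv g a - deriv g b| ≤ L * |a - b| := by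
  rcases eq_or_ne a b with rfl | hab
  · simp
  refine le_of_mul_le_mul_right ?_ (abs_pos.2 (sub_ne_zero.2 hab))
  rw [← abs_mul]
  have h1 := hg a b
  have h2 := hg b a
  rw [abs_sub_comm b a] at h2
  have e : (deriv g a - deriv g b) * (a - b) =
      (g a - g b - deriv g b * (a - b)) + (g b - g a - deriv g a * (b - a)) := by ring
  rw [e]
  refine (abs_add_le _ _).trans ((add_le_add h1 h2).trans (le_of_eq ?_))
  ring

theorem gradient_comp_inner_add {H : Type*} [NormedAddCommGroup H] [InnerProductSpace ℝ H]
    [CompleteSpace H] {g : ℝ → ℝ} {r : H → ℝ} (hg : Differentiable ℝ g) (hr : Differentiable ℝ r)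
    (x θ : H) :
    gradient (fun θ' => g ⟪x, θ'⟫ + r θ') θ = deriv g ⟪x, θ⟫ • x + gradient r θ := by
  refine HasGradientAt.gradient ?_
  rw [hasGradientAt_iff_hasFDerivAt, map_add]
  refine HasFDerivAt.add ?_ (hr θ).hasGradientAt.hasFDerivAt
  have := (hg ⟪x, θ⟫).hasDerivAt.comp_hasFDerivAt θ (innerSL ℝ x).hasFDerivAt
  rw [map_smulₛₗ]
  exact this

theorem stmt_1 (D L1 L2 B : ℝ) (hD : 0 < D) (hL1 : 0 < L1) (hL2 : 0 < L2) (hB : 0 < B) :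
    ∃ C1 : ℝ, 0 < C1 ∧
    ∀ (n d : ℕ), 2 ≤ n → 1 ≤ d →
    ∀ (Θ : Set (EuclideanSpace ℝ (Fin d))),
      Θ.Nonempty → IsCompact Θ → Metric.diam Θ ≤ D →
    ∀ (Y : Type) (x : Fin n → EuclideanSpace ℝ (Fin d)) (y : Fin n → Y)
      (f : ℝ → Y → ℝ) (r : EuclideanSpace ℝ (Fin d) → ℝ),
      (∀ yy : Y, Differentiable ℝ (fun a => f a yy)) →
      (∀ (yy : Y) (a b : ℝ), |f a yy - f b yy| ≤ L1 * |a - b|) →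
      (∀ (yy : Y) (a b : ℝ),
        |f a yy - f b yy - deriv (fun c => f c yy) b * (a - b)| ≤ L2 / 2 * |a - b| ^ 2) →
      (∀ i, ‖x i‖ ≤ B) →
      Differentiable ℝ r →
    ∀ θstar : EuclideanSpace ℝ (Fin d), θstar ∈ Θ →
      (∀ θ ∈ Θ, (n : ℝ)⁻¹ * ∑ i, (f ⟪x i, θstar⟫ (y i) + r θstar) ≤
        (n : ℝ)⁻¹ * ∑ i, (f ⟪x i, θ⟫ (y i) + r θ)) →
    ∀ a : ℕ, 1 ≤ a → a < n →
      ((Fintype.card (Equiv.Perm (Fin n)) : ℝ))⁻¹ *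
        ∑ σ : Equiv.Perm (Fin n),
          (sSup { v : ℝ | ∃ θ ∈ Θ, θ ≠ θstar ∧
            v = ⟪(a : ℝ)⁻¹ • (∑ i ∈ Finset.univ.filter (fun i : Fin n => (i : ℕ) < a),
                    gradient (fun θ' => f ⟪x (σ i), θ'⟫ (y (σ i)) + r θ') θ) -
                  ((n : ℝ) - a)⁻¹ • (∑ i ∈ Finset.univ.filter (fun i : Fin n => a ≤ (i : ℕ)),
                    gradient (fun θ' => f ⟪x (σ i), θ'⟫ (y (σ i)) + r θ') θ),
                ‖θ - θstar‖⁻¹ • (θ - θstar)⟫ }) ^ 2 ≤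
      C1 ^ 2 * (1 / Real.sqrt a + 1 / Real.sqrt ((n : ℝ) - a)) ^ 2 := by
  set K : ℝ := 3 * (D + 2) * (L2 * B * B + L1 * B + (2 * (L1 * B) + L2 * B * (B * D))) with hK
  refine ⟨2 * K, by positivity, ?_⟩
  intro n d _ _ Θ _ hΘ hdiam Y x y f r hf hLip hsmooth hx hr θstar hθstar _ a ha han
  obtain ⟨m, rfl⟩ := Nat.exists_eq_add_of_le han.le
  have hm0 : 0 < m := by omega
  have hapos : (0 : ℝ) < a := by exact_mod_cast ha
  have hmpos : (0 : ℝ) < m := by exact_mod_cast hm0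
  have hsub : ((a + m : ℕ) : ℝ) - a = m := by push_cast; ring
  rw [hsub, inv_mul_le_iff₀ (by exact_mod_cast Fintype.card_pos)]
  set g : Fin (a + m) → EuclideanSpace ℝ (Fin d) → ℝ := fun i θ =>
    deriv (fun c => f c (y i)) ⟪x i, θ⟫ * ⟪x i, ‖θ - θstar‖⁻¹ • (θ - θstar)⟫ with hg
  have hvalue (σ : Equiv.Perm (Fin (a + m))) (θ : EuclideanSpace ℝ (Fin d)) :
      ⟪(a : ℝ)⁻¹ • (∑ i ∈ Finset.univ.filter (fun i : Fin (a + m) => (i : ℕ) < a),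
            gradient (fun θ' => f ⟪x (σ i), θ'⟫ (y (σ i)) + r θ') θ) -
          (m : ℝ)⁻¹ • (∑ i ∈ Finset.univ.filter (fun i : Fin (a + m) => a ≤ (i : ℕ)),
            gradient (fun θ' => f ⟪x (σ i), θ'⟫ (y (σ i)) + r θ') θ),
        ‖θ - θstar‖⁻¹ • (θ - θstar)⟫ =
      (a : ℝ)⁻¹ * ∑ i, g (σ (Fin.castAdd m i)) θ -
        (m : ℝ)⁻¹ * ∑ k, g (σ (Fin.natAdd a k)) θ := by
    have hgrad (i : Fin (a + m)) :
        gradient (fun θ' => f ⟪x i, θ'⟫ (y i) + r θ') θ =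
          deriv (fun c => f c (y i)) ⟪x i, θ⟫ • x i + gradient r θ :=
      gradient_comp_inner_add (hf (y i)) hr (x i) θ
    simp_rw [hgrad, Finset.sum_filter, Fin.sum_univ_add]
    simp only [Fin.val_castAdd, Fin.is_lt, if_true, Fin.val_natAdd, not_lt.2 (Nat.le_add_right a _),
      if_false, Finset.sum_const_zero, add_zero, zero_add, Nat.le_add_right, not_le.2 (Fin.is_lt _)]
    simp_rw [inner_sub_left, real_inner_smul_left, sum_inner, inner_add_left, real_inner_smul_left,
      Finset.sum_add_distrib, Finset.sum_const, Finset.card_univ, Fintype.card_fin, nsmul_eq_mul,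
      hg, mul_add, inv_mul_cancel_left₀ hapos.ne', inv_mul_cancel_left₀ hmpos.ne']
    ring
  simp_rw [hvalue]
  have hunit (θ : EuclideanSpace ℝ (Fin d)) : ‖‖θ - θstar‖⁻¹ • (θ - θstar)‖ ≤ 1 := by
    rw [norm_smul, norm_inv, norm_norm]
    exact inv_mul_le_one
  have hderiv (i : Fin (a + m)) (b : ℝ) : |deriv (fun c => f c (y i)) b| ≤ L1 :=
    abs_deriv_le_of_forall_abs_sub_le hL1.le (hLip (y i)) b
  have hgbdd (i : Fin (a + m)) (θ : EuclideanSpace ℝ (Fin d)) : |g i θ| ≤ L1 * B := by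
    rw [hg, abs_mul]
    gcongr
    · exact hderiv _ _
    · calc _ ≤ ‖x i‖ * ‖‖θ - θstar‖⁻¹ • (θ - θstar)‖ := abs_real_inner_le_norm _ _
        _ ≤ B * 1 := by
          gcongr
          exacts [hx i, hunit θ]
        _ = B := mul_one B
  rcases (Θ \ {θstar}).eq_empty_or_nonempty with hempty | ⟨θ₀, hθ₀, hθ₀'⟩
  · have hall (θ) (hθ : θ ∈ Θ) : θ = θstar := Set.sdiff_eq_empty.1 hempty hθ
    have hzero (F : EuclideanSpace ℝ (Fin d) → ℝ) :
        sSup {v : ℝ | ∃ θ ∈ Θ, θ ≠ θstar ∧ v = F θ} = 0 := by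
      rw [← Real.sSup_empty]
      congr 1
      refine Set.eq_empty_of_forall_notMem ?_
      rintro v ⟨θ, hθ, hne, -⟩
      exact hne (hall θ hθ)
    simp only [hzero, ne_eq, OfNat.ofNat_ne_zero, not_false_eq_true, zero_pow,
      Finset.sum_const_zero]
    positivity
  set V : Equiv.Perm (Fin (a + m)) → Set ℝ := fun σ => {v : ℝ | ∃ θ ∈ Θ, θ ≠ θstar ∧
    v = (a : ℝ)⁻¹ * ∑ i, g (σ (Fin.castAdd m i)) θ -
      (m : ℝ)⁻¹ * ∑ k, g (σ (Fin.natAdd a k)) θ}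
  have hne (σ) : (V σ).Nonempty := ⟨_, θ₀, hθ₀, hθ₀', rfl⟩
  have hbdd (σ) : BddAbove (V σ) := by
    refine ⟨(a : ℝ)⁻¹ * ∑ _i : Fin a, L1 * B - (m : ℝ)⁻¹ * ∑ _k : Fin m, -(L1 * B), ?_⟩
    rintro v ⟨θ, -, -, rfl⟩
    gcongr
    · exact (abs_le.1 (hgbdd _ _)).2
    · exact (abs_le.1 (hgbdd _ _)).1
  refine sum_sSup_sq_le V hne hbdd fun z hz => ?_
  choose θ hθ _ hzθ using hz
  have hmain := sum_perm_ciSup_sq_head_sub_tail_le (T := Equiv.Perm (Fin (a + m))) ha hm0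
    (fun i t => g i (θ t)) (sq_nonneg K) fun b j => by
      simpa [hK] using sum_signs_ciSup_sq_mul_inner_le hD.le hL1.le hL2.le hB.le
        (fun i => x (j i)) (fun i => hx _) (fun t => θ t - θstar)
        (fun t => ‖θ t - θstar‖⁻¹ • (θ t - θstar))
        (fun t => by
          rw [← dist_eq_norm]
          exact (Metric.dist_le_diam_of_mem hΘ.isBounded (hθ t) hθstar).trans hdiam)
        (fun t => hunit (θ t))
        (fun i t => deriv (fun c => f c (y (j i))) ⟪x (j i), θ t⟫)
        (fun i t => hderiv _ _)
        (fun i s t => by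
          rw [inner_sub_right, inner_sub_right, sub_sub_sub_cancel_right]
          exact abs_deriv_sub_deriv_le (hsmooth (y (j i))) _ _)
  rw [show (2 * K) ^ 2 = 4 * K ^ 2 by ring]
  refine le_trans ?_ hmain
  refine Finset.sum_le_sum fun σ _ => ?_
  rw [hzθ σ]
  exact le_ciSup_of_finite (fun t => ((a : ℝ)⁻¹ * ∑ i, g (σ (Fin.castAdd m i)) (θ t) -
    (m : ℝ)⁻¹ * ∑ k, g (σ (Fin.natAdd a k)) (θ t)) ^ 2) σ
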